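/- arXiv:2111.06516 — 2 statements merged into one kernel-verified Lean document; each statement's English description precedes it below -/
import Mathlib

section
/- Let (X_k)_{k≥0}, (W_k)_{k≥1} be a Riccati iteration sequence in which every W_{k+1} is a stabilizing solution of its step Riccati equation, i.e. E⁻¹(A_k − B₂B₂ᵀW_{k+1}E) is stable. Then every W_{k+1} is positive semidefinite and the iterates are monotonically nondecreasing in the Loewner order: 0 = X₀ ≤ X₁ ≤ X₂ ≤ ⋯ ; in particular each X_k is symmetric positive semidefinite. -/
open Matrix

/-- The Riccati operator `R(X) = AᵀXE + EᵀXA − EᵀX(B₂B₂ᵀ − B₁B₁ᵀ)XE + CᵀC`. -/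
noncomputable def Ric {n m₁ m₂ p : ℕ} (A E : Matrix (Fin n) (Fin n) ℝ)
    (B₁ : Matrix (Fin n) (Fin m₁) ℝ) (B₂ : Matrix (Fin n) (Fin m₂) ℝ)
    (C : Matrix (Fin p) (Fin n) ℝ) (X : Matrix (Fin n) (Fin n) ℝ) :
    Matrix (Fin n) (Fin n) ℝ :=
  Aᵀ * X * E + Eᵀ * X * A - Eᵀ * X * (B₂ * B₂ᵀ - B₁ * B₁ᵀ) * X * E + Cᵀ * C

/-- A real square matrix is stable if all of its eigenvalues (as a complex matrix)
have negative real part. -/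
def IsStableMat {n : ℕ} (M : Matrix (Fin n) (Fin n) ℝ) : Prop :=
  ∀ μ ∈ spectrum ℂ (M.map (algebraMap ℝ ℂ)), μ.re < 0

/-- A Riccati iteration sequence: symmetric matrices `X k` (k ≥ 0) and `W k` (k ≥ 1)
with `X 0 = 0`, `X (k+1) = X k + W (k+1)`, and `W (k+1)` solving the step Riccati
equation with coefficient `A_k = A + (B₁B₁ᵀ − B₂B₂ᵀ)X_kE`. -/
noncomputable def RiccatiIter {n m₁ m₂ p : ℕ} (A E : Matrix (Fin n) (Fin n) ℝ)
    (B₁ : Matrix (Fin n) (Fin m₁) ℝ) (B₂ : Matrix (Fin n) (Fin m₂) ℝ)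
    (C : Matrix (Fin p) (Fin n) ℝ)
    (X W : ℕ → Matrix (Fin n) (Fin n) ℝ) : Prop :=
  X 0 = 0 ∧ (∀ k, (X k).IsSymm) ∧ (∀ k, (W (k + 1)).IsSymm) ∧
  (∀ k, X (k + 1) = X k + W (k + 1)) ∧
  (∀ k, (A + (B₁ * B₁ᵀ - B₂ * B₂ᵀ) * X k * E)ᵀ * W (k + 1) * E
      + Eᵀ * W (k + 1) * (A + (B₁ * B₁ᵀ - B₂ * B₂ᵀ) * X k * E)
      - Eᵀ * W (k + 1) * (B₂ * B₂ᵀ) * W (k + 1) * E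
      + Ric A E B₁ B₂ C (X k) = 0)

open Filter Topology in
theorem tendsto_pow_zero_of_spectralRadius_lt_one {R : Type*} [NormedRing R] [NormedAlgebra ℂ R]
    [CompleteSpace R] {a : R} (ha : spectralRadius ℂ a < 1) :
    Tendsto (fun k : ℕ => a ^ k) atTop (𝓝 0) := by
  obtain ⟨r, har, hr⟩ := exists_between ha
  have hev : ∀ᶠ k : ℕ in atTop, (‖a ^ k‖₊ : ENNReal) ≤ r ^ k := by
    filter_upwards [(spectrum.pow_nnnorm_pow_one_div_tendsto_nhds_spectralRadius a).eventually_lt_const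
      har, eventually_gt_atTop 0] with k hk hk0
    have hk' : (0 : ℝ) < k := by exact_mod_cast hk0
    rw [one_div] at hk
    rw [← ENNReal.rpow_natCast]
    exact (ENNReal.rpow_inv_le_iff hk').mp hk.le
  have h := tendsto_of_tendsto_of_tendsto_of_le_of_le' tendsto_const_nhds
    (ENNReal.tendsto_pow_atTop_nhds_zero_of_lt_one hr)
    (Eventually.of_forall fun k : ℕ => zero_le (a := (‖a ^ k‖₊ : ENNReal))) hev
  rw [tendsto_zero_iff_norm_tendsto_zero]
  rw [← ENNReal.coe_zero, ENNReal.tendsto_coe] at h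
  exact NNReal.tendsto_coe.mpr h

/-- The Cayley transform maps an element with spectrum in the open left half-plane to one with
spectrum in the open unit disc. -/
theorem norm_lt_one_of_mem_spectrum_cayley {R : Type*} [Ring R] [Algebra ℂ R] {a b : R}
    (ha : ∀ μ ∈ spectrum ℂ a, μ.re < 0) (hab : (1 - a) * b = 1) (hba : b * (1 - a) = 1)
    {z : ℂ} (hz : z ∈ spectrum ℂ ((1 + a) * b)) : ‖z‖ < 1 := by
  have hb : IsUnit b := ⟨⟨b, 1 - a, hba, hab⟩, rfl⟩
  have hfac : algebraMap ℂ R z - (1 + a) * b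
      = (algebraMap ℂ R (z - 1) - (z + 1) • a) * b := by
    calc algebraMap ℂ R z - (1 + a) * b
        = algebraMap ℂ R z * ((1 - a) * b) - (1 + a) * b := by rw [hab, mul_one]
      _ = _ := by
        rw [← mul_assoc, ← sub_mul]
        simp only [Algebra.algebraMap_eq_smul_one, add_smul, sub_smul, smul_mul_assoc, one_mul,
          one_smul, smul_sub]
        congr 1
        abel
  rw [spectrum.mem_iff, hfac, hb.mul_right_iff] at hz
  have hz1 : z + 1 ≠ 0 := fun h => hz <| by
    rw [h, zero_smul, sub_zero, eq_neg_of_add_eq_zero_left h]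
    exact (IsUnit.mk0 (-1 - 1 : ℂ) (by norm_num)).map (algebraMap ℂ R)
  have hmem : (z - 1) / (z + 1) ∈ spectrum ℂ a := fun h => hz <| by
    have h' := ((IsUnit.mk0 _ hz1).map (algebraMap ℂ R)).mul h
    rwa [mul_sub, ← map_mul, mul_div_cancel₀ _ hz1, ← Algebra.smul_def] at h'
  have hre := ha _ hmem
  have hpos : 0 < Complex.normSq (z + 1) := Complex.normSq_pos.mpr hz1
  rw [Complex.div_re, ← add_div, div_neg_iff] at hre
  have hnum := (hre.resolve_left fun h => absurd h.2 hpos.le.not_gt).1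
  simp only [Complex.sub_re, Complex.add_re, Complex.one_re, Complex.sub_im, Complex.add_im,
    Complex.one_im] at hnum
  rw [← sq_lt_one_iff₀ (norm_nonneg z), ← Complex.normSq_eq_norm_sq, Complex.normSq_apply]
  nlinarith

open Filter Topology in
/-- A symmetric solution of the Stein inequality `NᵀPN ≤ P` with `N` power-convergent to zero is
positive semidefinite. -/
theorem Matrix.PosSemidef.of_stein {n : Type*} [Fintype n] [DecidableEq n]
    {N P : Matrix n n ℝ} (hP : P.IsSymm) (hN : Tendsto (fun k : ℕ => N ^ k) atTop (𝓝 0))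
    (h : (P - Nᵀ * P * N).PosSemidef) : P.PosSemidef := by
  have hk : ∀ k : ℕ, (P - (N ^ k)ᵀ * P * N ^ k).PosSemidef := by
    intro k
    induction k with
    | zero => simpa using Matrix.PosSemidef.zero
    | succ k ih =>
      have h' := h.add (ih.conjTranspose_mul_mul_same N)
      rw [conjTranspose_eq_transpose_of_trivial] at h'
      convert h' using 1
      rw [pow_succ, transpose_mul]
      noncomm_ring
  refine .of_dotProduct_mulVec_nonneg ?_ fun x => ?_
  · rw [Matrix.IsHermitian, conjTranspose_eq_transpose_of_trivial, hP.eq]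
  · have hcont : Continuous fun T : Matrix n n ℝ => star x ⬝ᵥ ((P - Tᵀ * P * T) *ᵥ x) := by
      fun_prop
    have hlim := (hcont.tendsto 0).comp hN
    simp only [transpose_zero, zero_mul, mul_zero, sub_zero] at hlim
    exact ge_of_tendsto' hlim fun k => (hk k).dotProduct_mulVec_nonneg x

open Filter Topology in
theorem Matrix.tendsto_pow_zero_of_forall_norm_lt_one {n : Type*} [Fintype n] [DecidableEq n]
    {N : Matrix n n ℂ} (hN : ∀ z ∈ spectrum ℂ N, ‖z‖ < 1) :
    Tendsto (fun k : ℕ => N ^ k) atTop (𝓝 0) := by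
  cases isEmpty_or_nonempty n
  · simp only [Subsingleton.elim _ (0 : Matrix n n ℂ)]
    exact tendsto_const_nhds
  · let := Matrix.linftyOpNormedRing (n := n) (α := ℂ)
    let := Matrix.linftyOpNormedAlgebra (n := n) (α := ℂ) (R := ℂ)
    exact tendsto_pow_zero_of_spectralRadius_lt_one (by
      exact_mod_cast spectrum.spectralRadius_lt_of_forall_lt N (r := 1) fun z hz =>
        by exact_mod_cast hN z hz)

/-- Lyapunov's theorem: if `M` is stable, a symmetric solution `P` of `MᵀP + PM + Q = 0` with
`Q` positive semidefinite is positive semidefinite. -/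
theorem IsStableMat.posSemidef_of_lyapunov {n : ℕ} {M P Q : Matrix (Fin n) (Fin n) ℝ}
    (hM : IsStableMat M) (hP : P.IsSymm) (hQ : Q.PosSemidef) (h : Mᵀ * P + P * M + Q = 0) :
    P.PosSemidef := by
  let φ : Matrix (Fin n) (Fin n) ℝ →+* Matrix (Fin n) (Fin n) ℂ := (algebraMap ℝ ℂ).mapMatrix
  have hφM : φ M = M.map (algebraMap ℝ ℂ) := rfl
  have hunit : IsUnit (1 - M).det := by
    have h1 : IsUnit (φ (1 - M)) := by
      have : (1 : ℂ) ∉ spectrum ℂ (φ M) := fun h1 => absurd (hM 1 h1) (by simp)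
      rw [spectrum.notMem_iff, map_one] at this
      rwa [map_sub, map_one]
    rw [Matrix.isUnit_iff_isUnit_det, ← RingHom.map_det, isUnit_iff_ne_zero, map_ne_zero] at h1
    exact h1.isUnit
  set b := (1 - M)⁻¹
  have hab : (1 - M) * b = 1 := Matrix.mul_nonsing_inv _ hunit
  have hba : b * (1 - M) = 1 := Matrix.nonsing_inv_mul _ hunit
  have hlimC := Matrix.tendsto_pow_zero_of_forall_norm_lt_one fun z hz =>
    norm_lt_one_of_mem_spectrum_cayley (a := φ M) (b := φ b) hM
      (by rw [← map_one φ, ← map_sub, ← map_mul, hab])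
      (by rw [← map_one φ, ← map_sub, ← map_mul, hba]) (z := z) hz
  have hlim : Filter.Tendsto (fun k : ℕ => ((1 + M) * b) ^ k) Filter.atTop (nhds 0) := by
    have hre : Continuous fun T : Matrix (Fin n) (Fin n) ℂ => T.map Complex.re :=
      continuous_id.matrix_map Complex.continuous_re
    have h1 := (hre.tendsto 0).comp hlimC
    have h2 : ∀ k : ℕ, ((1 + M) * b) ^ k
        = ((φ (1 + M) * φ b) ^ k).map Complex.re := by
      intro k
      rw [← map_mul, ← map_pow]
      ext i j
      simp [φ]
    simp only [h2, map_add, map_one]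
    simpa [Function.comp_def] using h1
  refine Matrix.PosSemidef.of_stein hP hlim ?_
  have hbt : bᵀ * (1 - M)ᵀ = 1 := by rw [← Matrix.transpose_mul, hab, Matrix.transpose_one]
  have hQ' : Q = -(Mᵀ * P + P * M) := (neg_eq_of_add_eq_zero_right h).symm
  have hexp : P - ((1 + M) * b)ᵀ * P * ((1 + M) * b) = (2 : ℝ) • (bᴴ * Q * b) := by
    have h1 : P = bᵀ * ((1 - M)ᵀ * P * (1 - M)) * b := by
      calc P = (bᵀ * (1 - M)ᵀ) * P * ((1 - M) * b) := by rw [hbt, hab, one_mul, mul_one]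
        _ = _ := by simp only [mul_assoc]
    nth_rewrite 1 [h1]
    rw [hQ', two_smul, Matrix.conjTranspose_eq_transpose_of_trivial, Matrix.transpose_mul,
      Matrix.transpose_add, Matrix.transpose_sub, Matrix.transpose_one]
    noncomm_ring
  rw [hexp]
  exact (hQ.conjTranspose_mul_mul_same b).smul zero_le_two

theorem ric_add {n m₁ m₂ p : ℕ} (A E : Matrix (Fin n) (Fin n) ℝ)
    (B₁ : Matrix (Fin n) (Fin m₁) ℝ) (B₂ : Matrix (Fin n) (Fin m₂) ℝ)
    (C : Matrix (Fin p) (Fin n) ℝ) {X : Matrix (Fin n) (Fin n) ℝ} (hX : X.IsSymm)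
    (W : Matrix (Fin n) (Fin n) ℝ) :
    Ric A E B₁ B₂ C (X + W) = ((A + (B₁ * B₁ᵀ - B₂ * B₂ᵀ) * X * E)ᵀ * W * E
      + Eᵀ * W * (A + (B₁ * B₁ᵀ - B₂ * B₂ᵀ) * X * E)
      - Eᵀ * W * (B₂ * B₂ᵀ) * W * E + Ric A E B₁ B₂ C X)
      + Eᵀ * W * (B₁ * B₁ᵀ) * W * E := by
  simp only [Ric, Matrix.transpose_add, Matrix.transpose_mul, Matrix.transpose_sub,
    Matrix.transpose_transpose, hX.eq]
  generalize B₁ * B₁ᵀ = S₁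
  generalize B₂ * B₂ᵀ = S₂
  generalize Cᵀ * C = S₃
  noncomm_ring

theorem posSemidef_quadratic_term {n m : ℕ} {E W : Matrix (Fin n) (Fin n) ℝ} (hW : W.IsSymm)
    (B : Matrix (Fin n) (Fin m) ℝ) : (Eᵀ * W * (B * Bᵀ) * W * E).PosSemidef := by
  convert Matrix.posSemidef_conjTranspose_mul_self (Bᵀ * W * E) using 1
  simp only [Matrix.conjTranspose_eq_transpose_of_trivial, Matrix.transpose_mul,
    Matrix.transpose_transpose, hW.eq, Matrix.mul_assoc]

/-- A stabilizing solution `W` of the step Riccati equation with positive semidefinite constant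
term is positive semidefinite. -/
theorem posSemidef_of_stabilizing {n m : ℕ} {A E W Q : Matrix (Fin n) (Fin n) ℝ}
    (hE : IsUnit E.det) {B : Matrix (Fin n) (Fin m) ℝ} (hW : W.IsSymm) (hQ : Q.PosSemidef)
    (h : Aᵀ * W * E + Eᵀ * W * A - Eᵀ * W * (B * Bᵀ) * W * E + Q = 0)
    (hstab : IsStableMat (E⁻¹ * (A - B * Bᵀ * W * E))) : W.PosSemidef := by
  have hEi : E * E⁻¹ = 1 := Matrix.mul_nonsing_inv _ hE
  set M := E⁻¹ * (A - B * Bᵀ * W * E) with hMdef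
  have hA : A = E * M + B * Bᵀ * W * E := by
    rw [hMdef, ← Matrix.mul_assoc, hEi, Matrix.one_mul, sub_add_cancel]
  have hPsymm : (Eᵀ * W * E).IsSymm := by
    simp only [Matrix.IsSymm, Matrix.transpose_mul, Matrix.transpose_transpose, hW.eq,
      Matrix.mul_assoc]
  have hP : (Eᵀ * W * E).PosSemidef := by
    refine hstab.posSemidef_of_lyapunov hPsymm ((posSemidef_quadratic_term (E := E) hW B).add hQ) ?_
    rw [← h, hA]
    simp only [Matrix.transpose_add, Matrix.transpose_mul, Matrix.transpose_transpose, hW.eq]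
    generalize B * Bᵀ = S
    noncomm_ring
  have h' := hP.conjTranspose_mul_mul_same E⁻¹
  rw [Matrix.conjTranspose_eq_transpose_of_trivial] at h'
  have heq : E⁻¹ᵀ * (Eᵀ * W * E) * E⁻¹ = W := by
    calc E⁻¹ᵀ * (Eᵀ * W * E) * E⁻¹ = (E * E⁻¹)ᵀ * W * (E * E⁻¹) := by
          rw [Matrix.transpose_mul]; simp only [Matrix.mul_assoc]
      _ = W := by rw [hEi, Matrix.transpose_one, Matrix.one_mul, Matrix.mul_one]
  rwa [heq] at h'

/-- In a Riccati iteration with stabilizing step solutions, every update `W (k+1)` is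
positive semidefinite and the iterates are monotonically nondecreasing in the Loewner
order, starting from `X 0 = 0`; in particular each `X k` is positive semidefinite. -/
theorem riccati_iteration_monotone {n m₁ m₂ p : ℕ}
    (A E : Matrix (Fin n) (Fin n) ℝ) (hE : IsUnit E.det)
    (B₁ : Matrix (Fin n) (Fin m₁) ℝ) (B₂ : Matrix (Fin n) (Fin m₂) ℝ)
    (C : Matrix (Fin p) (Fin n) ℝ)
    (X W : ℕ → Matrix (Fin n) (Fin n) ℝ)
    (hiter : RiccatiIter A E B₁ B₂ C X W)
    (hstab : ∀ k : ℕ, IsStableMat (E⁻¹ * ((A + (B₁ * B₁ᵀ - B₂ * B₂ᵀ) * X k * E)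
      - B₂ * B₂ᵀ * W (k + 1) * E))) :
    (∀ k : ℕ, (W (k + 1)).PosSemidef) ∧
    (∀ k : ℕ, (X (k + 1) - X k).PosSemidef) ∧
    (∀ k : ℕ, (X k).PosSemidef) := by
  obtain ⟨hX0, hXs, hWs, hstep, heq⟩ := hiter
  have hRic : ∀ k, (Ric A E B₁ B₂ C (X k)).PosSemidef := by
    intro k
    cases k with
    | zero =>
      simpa [Ric, hX0, Matrix.conjTranspose_eq_transpose_of_trivial] using
        Matrix.posSemidef_conjTranspose_mul_self C
    | succ k =>
      rw [hstep, ric_add A E B₁ B₂ C (hXs k), heq, zero_add]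
      exact posSemidef_quadratic_term (hWs k) B₁
  have hW : ∀ k, (W (k + 1)).PosSemidef := fun k =>
    posSemidef_of_stabilizing hE (hWs k) (hRic k) (heq k) (hstab k)
  refine ⟨hW, fun k => ?_, fun k => ?_⟩
  · rw [hstep, add_sub_cancel_left]
    exact hW k
  · induction k with
    | zero => exact hX0 ▸ Matrix.PosSemidef.zero
    | succ k ih => exact hstep k ▸ ih.add (hW k)
end

section
/- Assume (A, B₂, E) is stabilizable, (A, C, E) has no unobservable purely imaginary modes, and there exists a stabilizing solution X∞ of the indefinite Riccati equation R(X) = 0. Let (X_k)_{k≥0}, (W_k)_{k≥1} be a Riccati iteration sequence in which every W_{k+1} is a stabilizing solution of its step Riccati equation. Then the convergence X_k → X∞ is locally quadratic: there exist a constant c > 0 and an index N such that for all k ≥ N, ‖X∞ − X_{k+1}‖ ≤ c‖X∞ − X_k‖², where ‖·‖ is a matrix norm. -/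
open Matrix

attribute [local instance] Matrix.frobeniusNormedAddCommGroup


open Filter Topology

section Spectrum

variable {n : ℕ}

lemma mem_spectrum_iff_exists_mulVec (M : Matrix (Fin n) (Fin n) ℂ) (μ : ℂ) :
    μ ∈ spectrum ℂ M ↔ ∃ v, v ≠ 0 ∧ M *ᵥ v = μ • v := by
  rw [spectrum.mem_iff, Matrix.isUnit_iff_isUnit_det, isUnit_iff_ne_zero, not_not,
    ← Matrix.exists_mulVec_eq_zero_iff]
  simp only [Matrix.sub_mulVec, Algebra.algebraMap_eq_smul_one, Matrix.smul_mulVec,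
    Matrix.one_mulVec, sub_eq_zero]
  exact exists_congr fun v => and_congr_right fun _ => eq_comm

lemma IsStableMat.re_neg {M : Matrix (Fin n) (Fin n) ℝ} (hM : IsStableMat M) {μ : ℂ}
    {v : Fin n → ℂ} (hv : v ≠ 0) (h : M.map (algebraMap ℝ ℂ) *ᵥ v = μ • v) : μ.re < 0 :=
  hM μ ((mem_spectrum_iff_exists_mulVec _ _).2 ⟨v, hv, h⟩)

lemma IsStableMat.mul_comm {M N : Matrix (Fin n) (Fin n) ℝ} (h : IsStableMat (M * N)) :
    IsStableMat (N * M) := by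
  intro μ hμ
  apply h μ
  rw [Matrix.mem_spectrum_iff_isRoot_charpoly] at hμ ⊢
  rwa [Matrix.map_mul, Matrix.charpoly_mul_comm, ← Matrix.map_mul]

lemma IsStableMat.transpose {M : Matrix (Fin n) (Fin n) ℝ} (h : IsStableMat M) :
    IsStableMat Mᵀ := by
  intro μ hμ
  apply h μ
  rw [Matrix.mem_spectrum_iff_isRoot_charpoly] at hμ ⊢
  rwa [Matrix.transpose_map, Matrix.charpoly_transpose] at hμ

lemma tendsto_pow_zero_of_spectrum {M : Matrix (Fin n) (Fin n) ℂ}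
    (h : ∀ μ ∈ spectrum ℂ M, ‖μ‖ < 1) : Tendsto (fun k : ℕ => M ^ k) atTop (𝓝 0) := by
  let _ : NormedRing (Matrix (Fin n) (Fin n) ℂ) := Matrix.frobeniusNormedRing
  let _ : NormedAlgebra ℂ (Matrix (Fin n) (Fin n) ℂ) := Matrix.frobeniusNormedAlgebra
  have hr : spectralRadius ℂ M < 1 := by
    rcases (spectrum ℂ M).eq_empty_or_nonempty with he | hne
    · simp [spectralRadius, he]
    · exact_mod_cast spectrum.spectralRadius_lt_of_forall_lt_of_nonempty hne (r := 1)
        fun μ hμ => by exact_mod_cast h μ hμ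
  obtain ⟨r, hMr, hr1⟩ := exists_between hr
  lift r to NNReal using (hr1.trans_le le_top).ne
  have hG := spectrum.pow_nnnorm_pow_one_div_tendsto_nhds_spectralRadius M
  have hr1' : r < 1 := by exact_mod_cast hr1
  have hpow : Tendsto (fun k : ℕ => (r : ℝ) ^ k) atTop (𝓝 0) :=
    tendsto_pow_atTop_nhds_zero_of_lt_one r.2 hr1'
  refine squeeze_zero_norm' ?_ hpow
  filter_upwards [hG.eventually_lt_const hMr, eventually_gt_atTop 0] with k hk hk0
  have hk' : (0 : ℝ) < k := by exact_mod_cast hk0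
  rw [one_div, ENNReal.rpow_inv_lt_iff hk', ENNReal.rpow_natCast] at hk
  have : ‖M ^ k‖₊ < r ^ k := by exact_mod_cast hk
  exact_mod_cast this.le

lemma eq_zero_of_mul_eq_mul_of_spectrum_disjoint {S T Z : Matrix (Fin n) (Fin n) ℂ}
    (hST : Disjoint (spectrum ℂ S) (spectrum ℂ T)) (h : S * Z = Z * T) : Z = 0 := by
  have hp : ∀ q : Polynomial ℂ,
      Polynomial.aeval S q * Z = Z * Polynomial.aeval T q := by
    intro q
    induction q using Polynomial.induction_on' with
    | add p q hp hq => simp only [map_add, add_mul, mul_add, hp, hq]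
    | monomial k a =>
      have hk : S ^ k * Z = Z * T ^ k := by
        induction k with
        | zero => simp
        | succ k ih => rw [pow_succ', pow_succ', mul_assoc, ih, ← mul_assoc, h, mul_assoc]
      simp only [Polynomial.aeval_monomial, ← Algebra.smul_def, smul_mul_assoc,
        mul_smul_comm, hk]
  have h1 := hp S.charpoly
  rw [Matrix.aeval_self_charpoly, zero_mul] at h1
  have hu : IsUnit (Polynomial.aeval T S.charpoly) := by
    rcases isEmpty_or_nonempty (Fin n) with he | hne
    · exact isUnit_of_subsingleton _
    have hT : (spectrum ℂ T).Nonempty :=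
      spectrum.nonempty_of_isAlgClosed_of_finiteDimensional ℂ T
    rw [← spectrum.zero_notMem_iff ℂ, spectrum.map_polynomial_aeval_of_nonempty T _ hT]
    rintro ⟨μ, hμ, h0⟩
    exact Set.disjoint_left.1 hST (Matrix.mem_spectrum_iff_isRoot_charpoly.2 h0) hμ
  exact (hu.mul_left_eq_zero).1 h1.symm

lemma spectrum_re_nonpos_of_tendsto {M : ℕ → Matrix (Fin n) (Fin n) ℝ}
    {L : Matrix (Fin n) (Fin n) ℝ} (hM : ∀ k, IsStableMat (M k))
    (h : Tendsto M atTop (𝓝 L)) :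
    ∀ μ ∈ spectrum ℂ (L.map (algebraMap ℝ ℂ)), μ.re ≤ 0 := by
  intro μ hμ
  by_contra! hpos
  have hroot := Matrix.mem_spectrum_iff_isRoot_charpoly.1 hμ
  have hlow : ∀ k, μ.re ^ n ≤ ‖((M k).map (algebraMap ℝ ℂ)).charpoly.eval μ‖ := by
    intro k
    set p := ((M k).map (algebraMap ℝ ℂ)).charpoly with hp
    have hs : p.Splits := IsAlgClosed.splits p
    have hcard : p.roots.card = n := by
      rw [← hs.natDegree_eq_card_roots, hp, Matrix.charpoly_natDegree_eq_dim, Fintype.card_fin]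
    have hre : ∀ r ∈ p.roots, μ.re ≤ ‖μ - r‖ := by
      intro r hr
      have h1 := hM k r (Matrix.mem_spectrum_iff_isRoot_charpoly.2
        (Polynomial.isRoot_of_mem_roots hr))
      have h2 := Complex.re_le_norm (μ - r)
      rw [Complex.sub_re] at h2
      linarith
    have heval : p.eval μ = (p.roots.map fun r => μ - r).prod := by
      exact hs.eval_eq_prod_roots_of_monic (Matrix.charpoly_monic _) μ
    rw [heval, ← hcard]
    clear_value p
    generalize p.roots = s at hre
    induction s using Multiset.induction_on with
    | empty => simp
    | cons a s ih =>
      simp only [Multiset.mem_cons, forall_eq_or_imp] at hre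
      simp only [Multiset.card_cons, Multiset.map_cons, Multiset.prod_cons, norm_mul, pow_succ']
      exact mul_le_mul hre.1 (ih hre.2) (by positivity) (norm_nonneg _)
  have hcont : Continuous fun N : Matrix (Fin n) (Fin n) ℝ =>
      ‖(N.map (algebraMap ℝ ℂ)).charpoly.eval μ‖ := by
    simp only [Matrix.eval_charpoly]
    have : Continuous (algebraMap ℝ ℂ) := Complex.continuous_ofReal
    fun_prop
  have hlim := (hcont.tendsto L).comp h
  have := ge_of_tendsto' hlim hlow
  rw [hroot.eq_zero, norm_zero] at this
  exact absurd this (not_le.2 (by positivity))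

end Spectrum

section Lyapunov

open scoped ComplexOrder

variable {n m : ℕ}

lemma Matrix.PosSemidef.map_complex {Z : Matrix (Fin n) (Fin n) ℝ} (hZ : Z.PosSemidef) :
    (Z.map (algebraMap ℝ ℂ)).PosSemidef := by
  have hH : (Z.map (algebraMap ℝ ℂ)).IsHermitian :=
    hZ.isHermitian.map _ fun x => (Complex.conj_ofReal x).symm
  refine .of_dotProduct_mulVec_nonneg hH fun v => ?_
  refine Complex.nonneg_iff.2 ⟨?_, (hH.im_star_dotProduct_mulVec_self v).symm⟩
  have h1 := hZ.dotProduct_mulVec_nonneg fun i => (v i).re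
  have h2 := hZ.dotProduct_mulVec_nonneg fun i => (v i).im
  refine (add_nonneg h1 h2).trans_eq ?_
  simp [dotProduct, mulVec, Complex.re_sum, Complex.im_sum, Finset.sum_add_distrib]

lemma IsStableMat.exists_one_sub_mul_eq_one {A : Matrix (Fin n) (Fin n) ℝ}
    (hA : IsStableMat A) : ∃ N : Matrix (Fin n) (Fin n) ℝ, (1 - A) * N = 1 := by
  have h1 : (1 : ℂ) ∉ spectrum ℂ (A.map (algebraMap ℝ ℂ)) := fun h => by
    have := hA 1 h
    norm_num at this
  rw [spectrum.notMem_iff, map_one, Matrix.isUnit_iff_isUnit_det] at h1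
  have h2 : ((1 : Matrix (Fin n) (Fin n) ℂ) - A.map (algebraMap ℝ ℂ)).det
      = algebraMap ℝ ℂ (1 - A).det := by
    rw [RingHom.map_det, RingHom.mapMatrix_apply, Matrix.map_sub _ (map_sub _),
      Matrix.map_one _ (map_zero _) (map_one _)]
  rw [h2, isUnit_iff_ne_zero, map_ne_zero] at h1
  exact ⟨(1 - A)⁻¹, Matrix.mul_nonsing_inv _ (isUnit_iff_ne_zero.2 h1)⟩

lemma norm_lt_one_of_cayley {μ l : ℂ} (hl : l.re < 0) (h : (1 + μ) * l = μ - 1) :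
    ‖μ‖ < 1 := by
  have hre := congrArg Complex.re h
  have him := congrArg Complex.im h
  simp at hre him
  rw [← sq_lt_one_iff₀ (norm_nonneg _), Complex.sq_norm, Complex.normSq_apply]
  have hpos : 0 < (1 + μ.re) ^ 2 + μ.im ^ 2 := by
    by_contra! hc
    have h1 : μ.im = 0 := by nlinarith [sq_nonneg (1 + μ.re), sq_nonneg μ.im]
    have h2 : 1 + μ.re = 0 := by nlinarith [sq_nonneg (1 + μ.re), sq_nonneg μ.im]
    rw [h1, h2] at hre
    linarith
  have key : μ.re * μ.re + μ.im * μ.im - 1 = l.re * ((1 + μ.re) ^ 2 + μ.im ^ 2) := by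
    linear_combination -(1 + μ.re) * hre - μ.im * him
  nlinarith

lemma IsStableMat.tendsto_cayley_pow {A N : Matrix (Fin n) (Fin n) ℝ} (hA : IsStableMat A)
    (hN : (1 - A) * N = 1) : Tendsto (fun k : ℕ => ((1 + A) * N) ^ k) atTop (𝓝 0) := by
  have hc : Tendsto (fun k : ℕ => (((1 + A) * N).map (algebraMap ℝ ℂ)) ^ k) atTop (𝓝 0) := by
    refine tendsto_pow_zero_of_spectrum fun μ hμ => ?_
    obtain ⟨v, hv, hMv⟩ := (mem_spectrum_iff_exists_mulVec _ _).1 hμ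
    set Ac := A.map (algebraMap ℝ ℂ)
    set w := N.map (algebraMap ℝ ℂ) *ᵥ v with hw
    have hvw : w - Ac *ᵥ w = v := by
      have h1 : (1 - Ac) * N.map (algebraMap ℝ ℂ) = 1 := by
        have := congrArg (fun X : Matrix (Fin n) (Fin n) ℝ => X.map (algebraMap ℝ ℂ)) hN
        simpa only [Matrix.map_mul, Matrix.map_sub _ (map_sub (algebraMap ℝ ℂ)),
          Matrix.map_one _ (map_zero (algebraMap ℝ ℂ)) (map_one (algebraMap ℝ ℂ))] using this
      have := congrArg (fun X => X *ᵥ v) h1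
      simpa only [← Matrix.mulVec_mulVec, Matrix.sub_mulVec, Matrix.one_mulVec] using this
    have hMw : w + Ac *ᵥ w = μ • v := by
      rw [← hMv, Matrix.map_mul, ← Matrix.mulVec_mulVec,
        Matrix.map_add _ (map_add (algebraMap ℝ ℂ)),
        Matrix.map_one _ (map_zero (algebraMap ℝ ℂ)) (map_one (algebraMap ℝ ℂ)),
        Matrix.add_mulVec, Matrix.one_mulVec]
    have hw0 : w ≠ 0 := by
      intro h0
      rw [h0, Matrix.mulVec_zero, sub_zero] at hvw
      exact hv hvw.symm
    have hrel : (1 + μ) • (Ac *ᵥ w) = (μ - 1) • w := by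
      rw [← hvw] at hMw
      ext i
      have := congrFun hMw i
      simp only [Pi.add_apply, Pi.smul_apply, Pi.sub_apply, smul_eq_mul] at this ⊢
      linear_combination this
    have hμ1 : 1 + μ ≠ 0 := by
      intro h0
      rw [h0, zero_smul, eq_comm, smul_eq_zero, or_iff_left hw0] at hrel
      have : (2 : ℂ) = 0 := by linear_combination h0 - hrel
      norm_num at this
    refine norm_lt_one_of_cayley (l := (μ - 1) / (1 + μ)) (hA.re_neg hw0 ?_)
      (mul_div_cancel₀ _ hμ1)
    rw [div_eq_inv_mul, ← smul_smul, ← hrel, inv_smul_smul₀ hμ1]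
  have hcont : Continuous fun Y : Matrix (Fin n) (Fin n) ℂ => Y.map Complex.re :=
    continuous_id.matrix_map Complex.continuous_re
  have h := (hcont.tendsto 0).comp hc
  convert h using 1
  · ext k i j
    simp only [Function.comp_apply, ← RingHom.mapMatrix_apply, ← map_pow]
    simp
  · simp

/-- **Lyapunov's theorem**, semidefinite version. -/
lemma IsStableMat.posSemidef_of_lyapunov_s9 {A Z P : Matrix (Fin n) (Fin n) ℝ}
    (hA : IsStableMat A) (hZ : Z.IsSymm) (hP : P.PosSemidef)
    (h : Aᵀ * Z + Z * A + P = 0) : Z.PosSemidef := by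
  obtain ⟨N, hN⟩ := hA.exists_one_sub_mul_eq_one
  have hM := hA.tendsto_cayley_pow hN
  set M := (1 + A) * N with hMdef
  have hstein : Z - Mᵀ * Z * M = Nᵀ * (P + P) * N := by
    have h1 : Z = Nᵀ * ((1 - A)ᵀ * Z * (1 - A)) * N := by
      calc Z = ((1 - A) * N)ᵀ * Z * ((1 - A) * N) := by simp [hN]
        _ = _ := by rw [transpose_mul]; noncomm_ring
    have h2 : Mᵀ * Z * M = Nᵀ * ((1 + A)ᵀ * Z * (1 + A)) * N := by
      rw [hMdef, transpose_mul]; noncomm_ring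
    have h3 : P = -(Aᵀ * Z + Z * A) := by rw [eq_neg_iff_add_eq_zero, add_comm]; exact h
    rw [h2, h3]
    nth_rewrite 1 [h1]
    rw [← Matrix.sub_mul, ← Matrix.mul_sub]
    congr 2
    simp only [transpose_sub, transpose_add, transpose_one]
    noncomm_ring
  refine .of_dotProduct_mulVec_nonneg hZ fun x => ?_
  have hstep : ∀ y, (M *ᵥ y) ⬝ᵥ Z *ᵥ (M *ᵥ y) ≤ y ⬝ᵥ Z *ᵥ y := by
    intro y
    have h1 := ((hP.add hP).conjTranspose_mul_mul_same N).dotProduct_mulVec_nonneg y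
    rw [conjTranspose_eq_transpose_of_trivial, ← hstein, sub_mulVec, dotProduct_sub,
      star_trivial, ← mulVec_mulVec, ← mulVec_mulVec, dotProduct_mulVec y Mᵀ, vecMul_transpose,
      sub_nonneg] at h1
    exact h1
  have hmono : ∀ k : ℕ, (M ^ k *ᵥ x) ⬝ᵥ Z *ᵥ (M ^ k *ᵥ x) ≤ x ⬝ᵥ Z *ᵥ x := by
    intro k
    induction k with
    | zero => simp
    | succ k ih => rw [pow_succ', ← mulVec_mulVec]; exact (hstep _).trans ih
  have hcont : Continuous fun Y : Matrix (Fin n) (Fin n) ℝ => (Y *ᵥ x) ⬝ᵥ Z *ᵥ (Y *ᵥ x) := by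
    fun_prop
  have hlim := (hcont.tendsto 0).comp hM
  simp only [zero_mulVec, zero_dotProduct] at hlim
  exact le_of_tendsto' hlim hmono

lemma isStableMat_of_lyapunov_of_output_injection {D Z P : Matrix (Fin n) (Fin n) ℝ}
    {B : Matrix (Fin n) (Fin m) ℝ} (hZ : Z.PosSemidef) (hP : P.PosSemidef)
    (h : Dᵀ * Z + Z * D + P + Z * (B * Bᵀ) * Z = 0)
    (hstab : IsStableMat (D + B * Bᵀ * Z)) : IsStableMat D := by
  intro μ hμ
  by_contra! hre
  obtain ⟨v, hv, hDv⟩ := (mem_spectrum_iff_exists_mulVec _ _).1 hμ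
  have hZc := hZ.map_complex
  have hPc := hP.map_complex
  have hc := congrArg (fun X : Matrix (Fin n) (Fin n) ℝ => X.map (algebraMap ℝ ℂ)) h
  have hct : ∀ {a b : ℕ} (Y : Matrix (Fin a) (Fin b) ℝ),
      Yᵀ.map (algebraMap ℝ ℂ) = (Y.map (algebraMap ℝ ℂ))ᴴ := by
    intro a b Y
    ext i j
    simp
  simp only [Matrix.map_mul, Matrix.map_add _ (map_add (algebraMap ℝ ℂ)), hct,
    Matrix.map_zero _ (map_zero (algebraMap ℝ ℂ))] at hc
  set Dc := D.map (algebraMap ℝ ℂ)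
  set Zc := Z.map (algebraMap ℝ ℂ)
  set Pc := P.map (algebraMap ℝ ℂ)
  set Bc := B.map (algebraMap ℝ ℂ)
  have hs := Complex.nonneg_iff.1 (hZc.dotProduct_mulVec_nonneg v)
  have hp := Complex.nonneg_iff.1 (hPc.dotProduct_mulVec_nonneg v)
  set u := Bcᴴ *ᵥ (Zc *ᵥ v) with hu
  have hb := Complex.nonneg_iff.1 (dotProduct_star_self_nonneg u)
  have hq : star μ * (star v ⬝ᵥ Zc *ᵥ v) + μ * (star v ⬝ᵥ Zc *ᵥ v) + star v ⬝ᵥ Pc *ᵥ v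
      + star u ⬝ᵥ u = 0 := by
    have h0 := congrArg (fun X => star v ⬝ᵥ X *ᵥ v) hc
    simp only [add_mulVec, dotProduct_add, zero_mulVec, dotProduct_zero] at h0
    rw [← h0]
    congr 1
    · congr 1
      congr 1
      · rw [← mulVec_mulVec, dotProduct_mulVec (star v) Dcᴴ, ← star_mulVec, hDv, star_smul, smul_dotProduct,
          smul_eq_mul]
      · rw [← mulVec_mulVec, hDv, mulVec_smul, dotProduct_smul, smul_eq_mul]
    · rw [hu, star_mulVec, star_mulVec, conjTranspose_conjTranspose, hZc.isHermitian.eq,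
        vecMul_vecMul, ← dotProduct_mulVec, mulVec_mulVec, mulVec_mulVec]
      simp only [Matrix.mul_assoc]
  have hq' := congrArg Complex.re hq
  simp only [Complex.add_re, Complex.mul_re, Complex.star_def, Complex.conj_re, Complex.conj_im,
    ← hs.2, mul_zero, sub_zero, Complex.zero_re] at hq'
  have hu0 : u = 0 := by
    rw [← dotProduct_star_self_eq_zero]
    refine Complex.ext ?_ hb.2.symm
    rw [Complex.zero_re]
    linarith [hb.1, hp.1, mul_nonneg hre hs.1]
  have := hstab.re_neg (μ := μ) hv (by
    rw [Matrix.map_add _ (map_add (algebraMap ℝ ℂ)), Matrix.map_mul, Matrix.map_mul, hct,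
      add_mulVec, hDv, ← mulVec_mulVec, ← mulVec_mulVec, ← hu, hu0, mulVec_zero, add_zero])
  linarith

lemma exists_tendsto_of_monotone_posSemidef {X : ℕ → Matrix (Fin n) (Fin n) ℝ}
    {U : Matrix (Fin n) (Fin n) ℝ} (hX : ∀ k, (X k).IsSymm)
    (hmono : ∀ k, (X (k + 1) - X k).PosSemidef) (hU : ∀ k, (U - X k).PosSemidef) :
    ∃ L, Tendsto X atTop (𝓝 L) := by
  have hq : ∀ x : Fin n → ℝ, ∃ l, Tendsto (fun k => x ⬝ᵥ X k *ᵥ x) atTop (𝓝 l) := by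
    intro x
    refine ⟨_, tendsto_atTop_ciSup (monotone_nat_of_le_succ fun k => ?_)
      ⟨x ⬝ᵥ U *ᵥ x, ?_⟩⟩
    · have := (hmono k).dotProduct_mulVec_nonneg x
      rwa [star_trivial, sub_mulVec, dotProduct_sub, sub_nonneg] at this
    · rintro _ ⟨k, rfl⟩
      have := (hU k).dotProduct_mulVec_nonneg x
      rwa [star_trivial, sub_mulVec, dotProduct_sub, sub_nonneg] at this
  choose l hl using hq
  let e : Fin n → Fin n → ℝ := fun i => Pi.single i 1
  refine ⟨Matrix.of fun i j => (l (e i + e j) - l (e i) - l (e j)) / 2,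
    tendsto_pi_nhds.2 fun i => tendsto_pi_nhds.2 fun j => ?_⟩
  have := (((hl (e i + e j)).sub (hl (e i))).sub (hl (e j))).div_const 2
  refine this.congr fun k => ?_
  have hs := (hX k).apply i j
  simp [e, mulVec_add, add_dotProduct, hs]
  ring

end Lyapunov

section Iteration

variable {n m₁ m₂ : ℕ}

lemma IsStableMat.eq_zero_of_sylvester {S T Z : Matrix (Fin n) (Fin n) ℝ}
    (hS : IsStableMat S) (hT : ∀ μ ∈ spectrum ℂ (T.map (algebraMap ℝ ℂ)), μ.re ≤ 0)
    (h : Sᵀ * Z + Z * T = 0) : Z = 0 := by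
  have hc := congrArg (fun X : Matrix (Fin n) (Fin n) ℝ => X.map (algebraMap ℝ ℂ)) h
  simp only [Matrix.map_mul, Matrix.map_add _ (map_add (algebraMap ℝ ℂ)),
    Matrix.map_zero _ (map_zero (algebraMap ℝ ℂ))] at hc
  rw [add_eq_zero_iff_eq_neg, ← mul_neg] at hc
  have hZ := eq_zero_of_mul_eq_mul_of_spectrum_disjoint (Set.disjoint_left.2 ?_) hc
  · ext i j
    simpa using congrFun (congrFun hZ i) j
  · intro μ h1 h2
    have h3 := hS.transpose μ h1
    rw [← spectrum.neg_eq, Set.mem_neg] at h2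
    have h4 := hT _ h2
    rw [Complex.neg_re] at h4
    linarith

attribute [local instance] Matrix.frobeniusNormedSpace

lemma IsStableMat.exists_norm_le_lyapunov {S : Matrix (Fin n) (Fin n) ℝ} (hS : IsStableMat S) :
    ∃ K : ℝ, 0 < K ∧ ∀ Z : Matrix (Fin n) (Fin n) ℝ, ‖Z‖ ≤ K * ‖Sᵀ * Z + Z * S‖ := by
  let f : Matrix (Fin n) (Fin n) ℝ →ₗ[ℝ] Matrix (Fin n) (Fin n) ℝ :=
    LinearMap.mulLeft ℝ Sᵀ + LinearMap.mulRight ℝ S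
  have hf : LinearMap.ker f = ⊥ :=
    LinearMap.ker_eq_bot'.2 fun Z hZ =>
      hS.eq_zero_of_sylvester (fun μ hμ => (hS μ hμ).le) hZ
  obtain ⟨K, hK0, hK⟩ := f.exists_antilipschitzWith hf
  refine ⟨K, hK0, fun Z => ?_⟩
  have := hK.le_mul_dist Z 0
  rwa [map_zero, dist_zero_right, dist_zero_right] at this

lemma posSemidef_sandwich {m : ℕ} {Z : Matrix (Fin n) (Fin n) ℝ} (hZ : Z.IsSymm)
    (B : Matrix (Fin n) (Fin m) ℝ) : (Z * (B * Bᵀ) * Z).PosSemidef := by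
  have h := posSemidef_conjTranspose_mul_self (Bᵀ * Z)
  rw [conjTranspose_eq_transpose_of_trivial, transpose_mul, transpose_transpose, hZ.eq] at h
  simpa only [Matrix.mul_assoc] using h

/-- The standard-form (`E = 1`) Riccati iteration, with `A` and the constant term `Q`
arbitrary, as the data shared by the convergence lemmas. -/
structure StandardRiccatiIter (A Q Y : Matrix (Fin n) (Fin n) ℝ)
    (B₁ : Matrix (Fin n) (Fin m₁) ℝ) (B₂ : Matrix (Fin n) (Fin m₂) ℝ)
    (X : ℕ → Matrix (Fin n) (Fin n) ℝ) : Prop where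
  posSemidef_const : Q.PosSemidef
  posSemidef_sol : Y.PosSemidef
  sol : Aᵀ * Y + Y * A + Y * (B₁ * B₁ᵀ - B₂ * B₂ᵀ) * Y + Q = 0
  stable_sol : IsStableMat (A + (B₁ * B₁ᵀ - B₂ * B₂ᵀ) * Y)
  zero : X 0 = 0
  symm : ∀ k, (X k).IsSymm
  step : ∀ k, (A + (B₁ * B₁ᵀ - B₂ * B₂ᵀ) * X k)ᵀ * (X (k + 1) - X k)
      + (X (k + 1) - X k) * (A + (B₁ * B₁ᵀ - B₂ * B₂ᵀ) * X k)
      - (X (k + 1) - X k) * (B₂ * B₂ᵀ) * (X (k + 1) - X k)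
      + (Aᵀ * X k + X k * A + X k * (B₁ * B₁ᵀ - B₂ * B₂ᵀ) * X k + Q) = 0
  stable_step : ∀ k, IsStableMat (A + B₁ * B₁ᵀ * X k - B₂ * B₂ᵀ * X (k + 1))

namespace StandardRiccatiIter

variable {A Q Y : Matrix (Fin n) (Fin n) ℝ} {B₁ : Matrix (Fin n) (Fin m₁) ℝ}
  {B₂ : Matrix (Fin n) (Fin m₂) ℝ} {X : ℕ → Matrix (Fin n) (Fin n) ℝ}

lemma residual_succ (h : StandardRiccatiIter A Q Y B₁ B₂ X) (k : ℕ) :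
    Aᵀ * X (k + 1) + X (k + 1) * A + X (k + 1) * (B₁ * B₁ᵀ - B₂ * B₂ᵀ) * X (k + 1) + Q
      = (X (k + 1) - X k) * (B₁ * B₁ᵀ) * (X (k + 1) - X k) := by
  have hs := h.step k
  simp only [transpose_add, transpose_sub, transpose_mul, transpose_transpose,
    (h.symm k).eq] at hs
  generalize Aᵀ = A', B₁ * B₁ᵀ = G₁, B₂ * B₂ᵀ = G₂ at hs ⊢
  linear_combination (norm := noncomm_ring) hs

lemma posSemidef_residual (h : StandardRiccatiIter A Q Y B₁ B₂ X) (k : ℕ) :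
    (Aᵀ * X k + X k * A + X k * (B₁ * B₁ᵀ - B₂ * B₂ᵀ) * X k + Q).PosSemidef := by
  cases k with
  | zero => simpa [h.zero] using h.posSemidef_const
  | succ k =>
    rw [h.residual_succ]
    exact posSemidef_sandwich ((h.symm _).sub (h.symm _)) B₁

lemma posSemidef_succ_sub (h : StandardRiccatiIter A Q Y B₁ B₂ X) (k : ℕ) :
    (X (k + 1) - X k).PosSemidef := by
  have hW : (X (k + 1) - X k).IsSymm := (h.symm _).sub (h.symm _)
  refine (h.stable_step k).posSemidef_of_lyapunov_s9 hW
    ((posSemidef_sandwich hW B₂).add (h.posSemidef_residual k)) ?_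
  have hs := h.step k
  simp only [transpose_add, transpose_sub, transpose_mul, transpose_transpose,
    (h.symm _).eq] at hs ⊢
  generalize Aᵀ = A', B₁ * B₁ᵀ = G₁, B₂ * B₂ᵀ = G₂ at hs ⊢
  linear_combination (norm := noncomm_ring) hs

lemma isSymm_sol (h : StandardRiccatiIter A Q Y B₁ B₂ X) : Y.IsSymm :=
  h.posSemidef_sol.isHermitian

lemma error_equation (h : StandardRiccatiIter A Q Y B₁ B₂ X) (k : ℕ) :
    (A + B₁ * B₁ᵀ * X k - B₂ * B₂ᵀ * Y)ᵀ * (Y - X (k + 1))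
      + (Y - X (k + 1)) * (A + B₁ * B₁ᵀ * X k - B₂ * B₂ᵀ * Y)
      + ((Y - X k) * (B₁ * B₁ᵀ) * (Y - X k)
        + (Y - X (k + 1)) * (B₂ * B₂ᵀ) * (Y - X (k + 1))) = 0 := by
  have hs := h.step k
  have hY := h.sol
  simp only [transpose_add, transpose_sub, transpose_mul, transpose_transpose,
    (h.symm _).eq, h.isSymm_sol.eq] at hs ⊢
  generalize Aᵀ = A', B₁ * B₁ᵀ = G₁, B₂ * B₂ᵀ = G₂ at hs hY ⊢
  linear_combination (norm := noncomm_ring) hY - hs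

lemma posSemidef_sol_sub (h : StandardRiccatiIter A Q Y B₁ B₂ X) (k : ℕ) :
    (Y - X k).PosSemidef := by
  induction k with
  | zero => simpa [h.zero] using h.posSemidef_sol
  | succ k ih =>
    have hZ : ∀ j, (Y - X j).IsSymm := fun j => h.isSymm_sol.sub (h.symm j)
    have hD : IsStableMat (A + B₁ * B₁ᵀ * X k - B₂ * B₂ᵀ * Y) := by
      refine isStableMat_of_lyapunov_of_output_injection (B := B₁) ih
        ((posSemidef_sandwich (hZ k) B₂).add (h.posSemidef_residual k)) ?_ ?_
      · have hY := h.sol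
        simp only [transpose_add, transpose_sub, transpose_mul, transpose_transpose,
          (h.symm _).eq, h.isSymm_sol.eq]
        generalize Aᵀ = A', B₁ * B₁ᵀ = G₁, B₂ * B₂ᵀ = G₂ at hY ⊢
        linear_combination (norm := noncomm_ring) hY
      · convert h.stable_sol using 1
        noncomm_ring
    exact hD.posSemidef_of_lyapunov_s9 (hZ _)
      ((posSemidef_sandwich (hZ k) B₁).add (posSemidef_sandwich (hZ _) B₂))
      (h.error_equation k)

lemma tendsto_sol (h : StandardRiccatiIter A Q Y B₁ B₂ X) : Tendsto X atTop (𝓝 Y) := by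
  obtain ⟨L, hL⟩ := exists_tendsto_of_monotone_posSemidef h.symm h.posSemidef_succ_sub
    h.posSemidef_sol_sub
  have hL' : Tendsto (fun k => X (k + 1)) atTop (𝓝 L) := (tendsto_add_atTop_iff_nat 1).2 hL
  have hres : Aᵀ * L + L * A + L * (B₁ * B₁ᵀ - B₂ * B₂ᵀ) * L + Q = 0 := by
    have hl : Continuous fun V : Matrix (Fin n) (Fin n) ℝ =>
        Aᵀ * V + V * A + V * (B₁ * B₁ᵀ - B₂ * B₂ᵀ) * V + Q := by fun_prop
    have hr : Continuous fun W : Matrix (Fin n) (Fin n) ℝ => W * (B₁ * B₁ᵀ) * W := by fun_prop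
    have h1 := (hl.tendsto L).comp hL'
    have h2 := (hr.tendsto _).comp (hL'.sub hL)
    refine (tendsto_nhds_unique (h1.congr h.residual_succ) h2).trans ?_
    simp
  have hspec := spectrum_re_nonpos_of_tendsto h.stable_step
    (L := A + B₁ * B₁ᵀ * L - B₂ * B₂ᵀ * L) <|
    (tendsto_const_nhds.add (hL.const_mul _)).sub (hL'.const_mul _)
  have hYL : Y - L = 0 := by
    refine h.stable_sol.eq_zero_of_sylvester hspec ?_
    have hY := h.sol
    simp only [transpose_add, transpose_sub, transpose_mul, transpose_transpose,
      h.isSymm_sol.eq]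
    generalize Aᵀ = A', B₁ * B₁ᵀ = G₁, B₂ * B₂ᵀ = G₂ at hY hres ⊢
    linear_combination (norm := noncomm_ring) hY - hres
  rwa [sub_eq_zero.1 hYL]

lemma norm_lyapunov_error_le (h : StandardRiccatiIter A Q Y B₁ B₂ X) (k : ℕ) :
    ‖(A + (B₁ * B₁ᵀ - B₂ * B₂ᵀ) * Y)ᵀ * (Y - X (k + 1))
        + (Y - X (k + 1)) * (A + (B₁ * B₁ᵀ - B₂ * B₂ᵀ) * Y)‖
      ≤ 2 * (‖B₁ * B₁ᵀ‖ * ‖Y - X k‖ * ‖Y - X (k + 1)‖) + ‖B₁ * B₁ᵀ‖ * ‖Y - X k‖ ^ 2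
        + ‖B₂ * B₂ᵀ‖ * ‖Y - X (k + 1)‖ ^ 2 := by
  have he := h.error_equation k
  have hid : (A + (B₁ * B₁ᵀ - B₂ * B₂ᵀ) * Y)ᵀ * (Y - X (k + 1))
        + (Y - X (k + 1)) * (A + (B₁ * B₁ᵀ - B₂ * B₂ᵀ) * Y)
      = (Y - X k) * (B₁ * B₁ᵀ) * (Y - X (k + 1)) + (Y - X (k + 1)) * (B₁ * B₁ᵀ) * (Y - X k)
        - (Y - X k) * (B₁ * B₁ᵀ) * (Y - X k)
        - (Y - X (k + 1)) * (B₂ * B₂ᵀ) * (Y - X (k + 1)) := by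
    simp only [transpose_add, transpose_sub, transpose_mul, transpose_transpose,
      (h.symm _).eq, h.isSymm_sol.eq] at he ⊢
    generalize Aᵀ = A', B₁ * B₁ᵀ = G₁, B₂ * B₂ᵀ = G₂ at he ⊢
    linear_combination (norm := noncomm_ring) he
  have h3 : ∀ U G V : Matrix (Fin n) (Fin n) ℝ, ‖U * G * V‖ ≤ ‖G‖ * ‖U‖ * ‖V‖ := by
    intro U G V
    refine (frobenius_norm_mul _ _).trans ?_
    rw [mul_comm ‖G‖]
    exact mul_le_mul_of_nonneg_right (frobenius_norm_mul _ _) (norm_nonneg _)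
  rw [hid]
  refine (norm_sub_le _ _).trans ?_
  have h4 := norm_sub_le ((Y - X k) * (B₁ * B₁ᵀ) * (Y - X (k + 1))
    + (Y - X (k + 1)) * (B₁ * B₁ᵀ) * (Y - X k)) ((Y - X k) * (B₁ * B₁ᵀ) * (Y - X k))
  have h5 := norm_add_le ((Y - X k) * (B₁ * B₁ᵀ) * (Y - X (k + 1)))
    ((Y - X (k + 1)) * (B₁ * B₁ᵀ) * (Y - X k))
  linarith [h3 (Y - X k) (B₁ * B₁ᵀ) (Y - X (k + 1)), h3 (Y - X (k + 1)) (B₁ * B₁ᵀ) (Y - X k),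
    h3 (Y - X k) (B₁ * B₁ᵀ) (Y - X k), h3 (Y - X (k + 1)) (B₂ * B₂ᵀ) (Y - X (k + 1))]

theorem quadratic_convergence (h : StandardRiccatiIter A Q Y B₁ B₂ X) :
    ∃ c : ℝ, 0 < c ∧ ∃ N : ℕ, ∀ k ≥ N, ‖Y - X (k + 1)‖ ≤ c * ‖Y - X k‖ ^ 2 := by
  obtain ⟨K, hK0, hK⟩ := h.stable_sol.exists_norm_le_lyapunov
  have hz : Tendsto (fun k => ‖Y - X k‖) atTop (𝓝 0) := by
    have := (tendsto_const_nhds (x := Y)).sub h.tendsto_sol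
    rw [sub_self] at this
    simpa using this.norm
  have hz' : Tendsto (fun k => ‖Y - X (k + 1)‖) atTop (𝓝 0) := (tendsto_add_atTop_iff_nat 1).2 hz
  have hsmall : Tendsto (fun k => K * (2 * ‖B₁ * B₁ᵀ‖ * ‖Y - X k‖
      + ‖B₂ * B₂ᵀ‖ * ‖Y - X (k + 1)‖)) atTop (𝓝 0) := by
    simpa using ((hz.const_mul (2 * ‖B₁ * B₁ᵀ‖)).add (hz'.const_mul ‖B₂ * B₂ᵀ‖)).const_mul K
  obtain ⟨N, hN⟩ := eventually_atTop.1 (hsmall.eventually_le_const (one_half_pos (α := ℝ)))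
  refine ⟨2 * K * ‖B₁ * B₁ᵀ‖ + 1, by positivity, N, fun k hk => ?_⟩
  have h1 := (hK _).trans (mul_le_mul_of_nonneg_left (h.norm_lyapunov_error_le k) hK0.le)
  have h2 := mul_le_mul_of_nonneg_right (hN k hk) (norm_nonneg (Y - X (k + 1)))
  nlinarith [sq_nonneg ‖Y - X k‖]

end StandardRiccatiIter

lemma eq_zero_of_transpose_mul_mul_eq_zero {E M : Matrix (Fin n) (Fin n) ℝ}
    (hE : IsUnit E.det) (h : Eᵀ * M * E = 0) : M = 0 := by
  have hu : IsUnit E := (Matrix.isUnit_iff_isUnit_det E).2 hE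
  rwa [hu.mul_left_eq_zero, ((Matrix.isUnit_transpose E).2 hu).mul_right_eq_zero] at h

lemma IsStableMat.of_inv_mul_mul {E M : Matrix (Fin n) (Fin n) ℝ} (hE : IsUnit E.det)
    (h : IsStableMat (E⁻¹ * (M * E))) : IsStableMat M := by
  have := h.mul_comm
  rwa [Matrix.mul_assoc, Matrix.mul_nonsing_inv _ hE, Matrix.mul_one] at this

end Iteration

/-- The convergence of the Riccati iteration is locally quadratic. -/
theorem riccati_iteration_quadratic_convergence {n m₁ m₂ p : ℕ}
    (A E : Matrix (Fin n) (Fin n) ℝ) (hE : IsUnit E.det)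
    (B₁ : Matrix (Fin n) (Fin m₁) ℝ) (B₂ : Matrix (Fin n) (Fin m₂) ℝ)
    (C : Matrix (Fin p) (Fin n) ℝ)
    (hstabilizable : ∃ K : Matrix (Fin m₂) (Fin n) ℝ, IsStableMat (E⁻¹ * (A - B₂ * K)))
    (hdetect : ∀ (l : ℂ) (v : Fin n → ℂ), l.re = 0 →
      (l • E.map (algebraMap ℝ ℂ) - A.map (algebraMap ℝ ℂ)).mulVec v = 0 →
      (C.map (algebraMap ℝ ℂ)).mulVec v = 0 → v = 0)
    (Xinf : Matrix (Fin n) (Fin n) ℝ) (hXinfPSD : Xinf.PosSemidef)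
    (hXinfSol : Ric A E B₁ B₂ C Xinf = 0)
    (hXinfStab : IsStableMat (E⁻¹ * (A + (B₁ * B₁ᵀ - B₂ * B₂ᵀ) * Xinf * E)))
    (X W : ℕ → Matrix (Fin n) (Fin n) ℝ)
    (hiter : RiccatiIter A E B₁ B₂ C X W)
    (hstab : ∀ k : ℕ, IsStableMat (E⁻¹ * ((A + (B₁ * B₁ᵀ - B₂ * B₂ᵀ) * X k * E)
      - B₂ * B₂ᵀ * W (k + 1) * E))) :
    ∃ c : ℝ, 0 < c ∧ ∃ N : ℕ, ∀ k ≥ N,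
      ‖Xinf - X (k + 1)‖ ≤ c * ‖Xinf - X k‖ ^ 2 := by
  obtain ⟨A', rfl⟩ : ∃ A', A = A' * E :=
    ⟨A * E⁻¹, by rw [Matrix.mul_assoc, Matrix.nonsing_inv_mul _ hE, Matrix.mul_one]⟩
  obtain ⟨C', rfl⟩ : ∃ C', C = C' * E :=
    ⟨C * E⁻¹, by rw [Matrix.mul_assoc, Matrix.nonsing_inv_mul _ hE, Matrix.mul_one]⟩
  obtain ⟨hX0, hXsymm, -, hXW, hstep⟩ := hiter
  have hW : ∀ k, W (k + 1) = X (k + 1) - X k := fun k => by rw [hXW k, add_sub_cancel_left]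
  have hRic : ∀ V, Ric (A' * E) E B₁ B₂ (C' * E) V
      = Eᵀ * (A'ᵀ * V + V * A' + V * (B₁ * B₁ᵀ - B₂ * B₂ᵀ) * V + C'ᵀ * C') * E := by
    intro V
    simp only [Ric, transpose_mul, Matrix.mul_add, Matrix.add_mul, Matrix.mul_sub,
      Matrix.sub_mul, Matrix.mul_assoc]
    abel
  have hiter' : StandardRiccatiIter A' (C'ᵀ * C') Xinf B₁ B₂ X :=
    { posSemidef_const := posSemidef_conjTranspose_mul_self C'
      posSemidef_sol := hXinfPSD
      sol := eq_zero_of_transpose_mul_mul_eq_zero hE ((hRic _).symm.trans hXinfSol)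
      stable_sol := .of_inv_mul_mul hE <| by
        rwa [Matrix.add_mul]
      zero := hX0
      symm := hXsymm
      step := fun k => eq_zero_of_transpose_mul_mul_eq_zero hE <| by
        have h := hstep k
        rw [hRic, hW] at h
        rw [← Matrix.add_mul, transpose_mul] at h
        refine Eq.trans ?_ h
        noncomm_ring
      stable_step := fun k => .of_inv_mul_mul hE <| by
        convert hstab k using 2
        rw [hW]
        noncomm_ring }
  exact hiter'.quadratic_convergence
end
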